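/- Let f(x, W) = f̃(W₁x, W₂) with f̃ differentiable, let x₁, …, xₙ ∈ ℝ^d be nonzero training points, W* = (W₁*, W₂*) an interpolation solution with w parameters, and k ≥ 1. Assume: (i) for every parameter coordinate j, (1/n) Σᵢ (∂f/∂W_j(xᵢ, W*))^{2k} ≤ 2^k B^{k−1}/η^k; and (ii) f satisfies the (C, δ_approx, k)-local smoothness condition at each (xᵢ, W*). Then for every index i ∈ {1, …, n} and every x ∈ ℝ^d with ‖x − xᵢ‖₂ ≤ δ, where δ ≤ δ_approx minⱼ ‖xⱼ‖₂ / ‖W₁*‖₂, the adversarial robustness bound holds: |f(x, W*) − f(xᵢ, W*)| ≤ (C √d ‖(W₁*)ᵀ‖_{2k} / minⱼ ‖xⱼ‖_{2k}) · ((2nw/B)^{1/(2k)} √(2B/η) + 1) · δ. -/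

import Mathlib

/-- Matrix–vector product of `W : ℝ^{m×d}` (as a function) with `x : ℝ^d`. -/
noncomputable def mVec {m d : ℕ} (W : Fin m → Fin d → ℝ) (x : Fin d → ℝ) : Fin m → ℝ :=
  fun r => ∑ s, W r s * x s

/-- Euclidean (ℓ²) norm of a vector in `ℝ^d`. -/
noncomputable def l2norm {d : ℕ} (v : Fin d → ℝ) : ℝ := Real.sqrt (∑ j, v j ^ 2)

/-- Operator norm of a matrix induced by Euclidean norms. -/
noncomputable def opNorm2 {m d : ℕ} (W : Fin m → Fin d → ℝ) : ℝ :=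
  sSup {r : ℝ | ∃ x : Fin d → ℝ, l2norm x = 1 ∧ r = l2norm (mVec W x)}

/-- ℓ^{2k} norm of a vector. -/
noncomputable def lpnorm (k : ℕ) {d : ℕ} (v : Fin d → ℝ) : ℝ :=
  (∑ j, |v j| ^ (2 * k)) ^ ((2 * k : ℝ))⁻¹

/-- Operator norm of a matrix induced by ℓ^{2k} norms on domain and codomain. -/
noncomputable def opNormP (k : ℕ) {m d : ℕ} (W : Fin m → Fin d → ℝ) : ℝ :=
  sSup {r : ℝ | ∃ x : Fin d → ℝ, lpnorm k x = 1 ∧ r = lpnorm k (mVec W x)}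

/-- Euclidean distance between two (flattened) parameter pairs `W = (W₁, W₂)`. -/
noncomputable def paramDist {m d p : ℕ}
    (W W' : (Fin m → Fin d → ℝ) × (Fin p → ℝ)) : ℝ :=
  Real.sqrt ((∑ r, ∑ s, (W.1 r s - W'.1 r s) ^ 2) + ∑ l, (W.2 l - W'.2 l) ^ 2)

/-- The ℓ^{2k} norm `‖∇_W F‖_{2k}` of the gradient of `F : (W₁, W₂) ↦ ℝ` with respect to all
(flattened) parameters. -/
noncomputable def gradWnorm {m d p : ℕ} (k : ℕ)
    (F : ((Fin m → Fin d → ℝ) × (Fin p → ℝ)) → ℝ)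
    (W : (Fin m → Fin d → ℝ) × (Fin p → ℝ)) : ℝ :=
  ((∑ r, ∑ s, |fderiv ℝ F W (Pi.single r (Pi.single s 1), 0)| ^ (2 * k))
    + ∑ l, |fderiv ℝ F W (0, Pi.single l 1)| ^ (2 * k)) ^ ((2 * k : ℝ))⁻¹

section Norms

variable {d m : ℕ} {k : ℕ}

lemma lpnorm_nonneg (v : Fin d → ℝ) : 0 ≤ lpnorm k v := by
  unfold lpnorm; positivity

lemma lpnorm_mono {v : Fin d → ℝ} {u : Fin d → ℝ} (h : ∀ j, |v j| ≤ |u j|) :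
    lpnorm k v ≤ lpnorm k u := by
  unfold lpnorm
  refine Real.rpow_le_rpow (by positivity) (Finset.sum_le_sum fun j _ => ?_) (by positivity)
  exact pow_le_pow_left₀ (abs_nonneg _) (h j) _

lemma rpow_inv_two_mul_pow (hk : 1 ≤ k) {a : ℝ} (ha : 0 ≤ a) :
    (a ^ (2 * k)) ^ ((2 * k : ℝ))⁻¹ = a := by
  have := Real.pow_rpow_inv_natCast ha (n := 2 * k) (by omega)
  push_cast at this
  exact this

lemma abs_le_lpnorm (hk : 1 ≤ k) (v : Fin d → ℝ) (j : Fin d) : |v j| ≤ lpnorm k v := by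
  rw [← rpow_inv_two_mul_pow hk (abs_nonneg (v j))]
  unfold lpnorm
  gcongr
  exact Finset.single_le_sum (f := fun j => |v j| ^ (2 * k)) (fun _ _ => by positivity)
    (Finset.mem_univ j)

lemma lpnorm_pos (hk : 1 ≤ k) {v : Fin d → ℝ} (hv : v ≠ 0) : 0 < lpnorm k v := by
  obtain ⟨j, hj⟩ := Function.ne_iff.mp hv
  exact (abs_pos.mpr hj).trans_le (abs_le_lpnorm hk v j)

lemma lpnorm_smul (hk : 1 ≤ k) (c : ℝ) (v : Fin d → ℝ) :
    lpnorm k (c • v) = |c| * lpnorm k v := by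
  unfold lpnorm
  simp only [Pi.smul_apply, smul_eq_mul, abs_mul, mul_pow, ← Finset.mul_sum]
  rw [Real.mul_rpow (by positivity) (by positivity), rpow_inv_two_mul_pow hk (abs_nonneg c)]

lemma l2norm_eq_lpnorm_one (v : Fin d → ℝ) : l2norm v = lpnorm 1 v := by
  simp [l2norm, lpnorm, Real.sqrt_eq_rpow]

lemma opNorm2_eq_opNormP_one (W : Fin m → Fin d → ℝ) : opNorm2 W = opNormP 1 W := by
  simp [opNorm2, opNormP, l2norm_eq_lpnorm_one]

lemma mVec_smul (W : Fin m → Fin d → ℝ) (c : ℝ) (v : Fin d → ℝ) :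
    mVec W (c • v) = c • mVec W v := by
  ext r
  simp only [mVec, Pi.smul_apply, smul_eq_mul, Finset.mul_sum]
  exact Finset.sum_congr rfl fun _ _ => by ring

lemma mVec_add (W : Fin m → Fin d → ℝ) (u v : Fin d → ℝ) :
    mVec W (u + v) = mVec W u + mVec W v := by
  ext r
  simp [mVec, mul_add, Finset.sum_add_distrib]

lemma bddAbove_opNormP (hk : 1 ≤ k) (W : Fin m → Fin d → ℝ) :
    BddAbove {r : ℝ | ∃ x : Fin d → ℝ, lpnorm k x = 1 ∧ r = lpnorm k (mVec W x)} := by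
  refine ⟨lpnorm k (fun r => ∑ s, |W r s|), ?_⟩
  rintro _ ⟨x, hx, rfl⟩
  refine lpnorm_mono fun r => ?_
  rw [abs_of_nonneg (a := ∑ s, |W r s|) (by positivity)]
  refine (Finset.abs_sum_le_sum_abs _ _).trans (Finset.sum_le_sum fun s _ => ?_)
  rw [abs_mul]
  exact mul_le_of_le_one_right (abs_nonneg _) (hx ▸ abs_le_lpnorm hk x s)

lemma opNormP_nonneg (W : Fin m → Fin d → ℝ) : 0 ≤ opNormP k W := by
  refine Real.sSup_nonneg ?_
  rintro _ ⟨x, -, rfl⟩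
  exact lpnorm_nonneg _

lemma lpnorm_mVec_le (hk : 1 ≤ k) (W : Fin m → Fin d → ℝ) (v : Fin d → ℝ) :
    lpnorm k (mVec W v) ≤ opNormP k W * lpnorm k v := by
  by_cases hv : v = 0
  · have hz : mVec W v = (0 : ℝ) • mVec W v := by
      rw [← mVec_smul, hv, smul_zero]
    rw [hz, lpnorm_smul hk, abs_zero, zero_mul]
    exact mul_nonneg (opNormP_nonneg W) (lpnorm_nonneg v)
  · have hpos := lpnorm_pos hk hv
    have hle : lpnorm k (mVec W ((lpnorm k v)⁻¹ • v)) ≤ opNormP k W := by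
      refine le_csSup (bddAbove_opNormP hk W) ⟨_, ?_, rfl⟩
      rw [lpnorm_smul hk, abs_of_pos (inv_pos.mpr hpos), inv_mul_cancel₀ hpos.ne']
    rw [mVec_smul, lpnorm_smul hk, abs_of_pos (inv_pos.mpr hpos)] at hle
    rwa [inv_mul_le_iff₀ hpos, mul_comm] at hle

lemma l2norm_mVec_le (W : Fin m → Fin d → ℝ) (v : Fin d → ℝ) :
    l2norm (mVec W v) ≤ opNorm2 W * l2norm v := by
  simpa only [l2norm_eq_lpnorm_one, opNorm2_eq_opNormP_one] using lpnorm_mVec_le le_rfl W v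

lemma abs_sum_mul_le_lpnorm_mul_l2norm (hk : 1 ≤ k) (u v : Fin d → ℝ) :
    |∑ s, u s * v s| ≤ lpnorm k u * (Real.sqrt d * l2norm v) := by
  have hl1 : ∑ s, |v s| ≤ Real.sqrt d * l2norm v := by
    have h := Real.sum_mul_le_sqrt_mul_sqrt Finset.univ (fun _ : Fin d => (1 : ℝ))
      (fun s => |v s|)
    simpa [l2norm] using h
  calc |∑ s, u s * v s| ≤ ∑ s, |u s| * |v s| := by
        simpa only [abs_mul] using Finset.abs_sum_le_sum_abs (fun s => u s * v s) Finset.univ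
    _ ≤ ∑ s, lpnorm k u * |v s| := by
        gcongr with s
        exact abs_le_lpnorm hk u s
    _ ≤ lpnorm k u * (Real.sqrt d * l2norm v) := by
        rw [← Finset.mul_sum]
        exact mul_le_mul_of_nonneg_left hl1 (lpnorm_nonneg u)

end Norms

section Gradient

variable {m d p : ℕ}

lemma fderiv_comp_mVec {ft : (Fin m → ℝ) → (Fin p → ℝ) → ℝ}
    (hft : Differentiable ℝ (fun q : (Fin m → ℝ) × (Fin p → ℝ) => ft q.1 q.2))
    (x : Fin d → ℝ) (W A : (Fin m → Fin d → ℝ) × (Fin p → ℝ)) :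
    fderiv ℝ (fun V : (Fin m → Fin d → ℝ) × (Fin p → ℝ) => ft (mVec V.1 x) V.2) W A =
      fderiv ℝ (fun q : (Fin m → ℝ) × (Fin p → ℝ) => ft q.1 q.2) (mVec W.1 x, W.2)
        (mVec A.1 x, A.2) := by
  let L : ((Fin m → Fin d → ℝ) × (Fin p → ℝ)) →ₗ[ℝ] (Fin m → ℝ) × (Fin p → ℝ) :=
    { toFun := fun V => (mVec V.1 x, V.2)
      map_add' := fun U V => by
        ext r
        · simp [mVec, add_mul, Finset.sum_add_distrib]
        · rfl
      map_smul' := fun c V => by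
        ext r
        · simp [mVec, Finset.mul_sum, mul_assoc]
        · rfl }
  have h := (hft (mVec W.1 x, W.2)).hasFDerivAt.comp W
    (L.toContinuousLinearMap.hasFDerivAt (x := W))
  have h' := congrArg (fun T => T A) h.fderiv
  exact h'

/-- The gradient with respect to the first-layer weights is the outer product of the
pre-activation gradient and the input. -/
lemma fderiv_comp_mVec_single {ft : (Fin m → ℝ) → (Fin p → ℝ) → ℝ}
    (hft : Differentiable ℝ (fun q : (Fin m → ℝ) × (Fin p → ℝ) => ft q.1 q.2))
    (x : Fin d → ℝ) (W : (Fin m → Fin d → ℝ) × (Fin p → ℝ)) (r : Fin m) (s : Fin d) :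
    fderiv ℝ (fun V : (Fin m → Fin d → ℝ) × (Fin p → ℝ) => ft (mVec V.1 x) V.2) W
        (Pi.single r (Pi.single s 1), 0) =
      x s * fderiv ℝ (fun q : (Fin m → ℝ) × (Fin p → ℝ) => ft q.1 q.2) (mVec W.1 x, W.2)
        (Pi.single r 1, 0) := by
  rw [fderiv_comp_mVec hft, ← smul_eq_mul, ← map_smul]
  congr 1
  ext t
  · by_cases h : t = r
    · subst h
      simp [mVec, Pi.single_apply]
    · simp [mVec, h]
  · simp

lemma lpnorm_mul_lpnorm_le_gradWnorm {k : ℕ} {ft : (Fin m → ℝ) → (Fin p → ℝ) → ℝ}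
    (hft : Differentiable ℝ (fun q : (Fin m → ℝ) × (Fin p → ℝ) => ft q.1 q.2))
    (x : Fin d → ℝ) (W : (Fin m → Fin d → ℝ) × (Fin p → ℝ)) :
    lpnorm k (fun r => fderiv ℝ (fun q : (Fin m → ℝ) × (Fin p → ℝ) => ft q.1 q.2)
        (mVec W.1 x, W.2) (Pi.single r 1, 0)) * lpnorm k x ≤
      gradWnorm k (fun V => ft (mVec V.1 x) V.2) W := by
  unfold gradWnorm lpnorm
  rw [← Real.mul_rpow (by positivity) (by positivity)]
  gcongr
  refine le_add_of_le_of_nonneg (le_of_eq ?_) (by positivity)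
  simp only [fderiv_comp_mVec_single hft]
  rw [Finset.sum_mul_sum]
  refine Finset.sum_congr rfl fun r _ => Finset.sum_congr rfl fun s _ => ?_
  rw [abs_mul, mul_pow, mul_comm]

lemma gradWnorm_le_of_pow_le {k : ℕ} {F : ((Fin m → Fin d → ℝ) × (Fin p → ℝ)) → ℝ}
    {W : (Fin m → Fin d → ℝ) × (Fin p → ℝ)} {M : ℝ}
    (h₁ : ∀ r s, (fderiv ℝ F W (Pi.single r (Pi.single s 1), 0)) ^ (2 * k) ≤ M)
    (h₂ : ∀ l, (fderiv ℝ F W (0, Pi.single l 1)) ^ (2 * k) ≤ M) :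
    gradWnorm k F W ≤ (((m * d + p : ℕ) : ℝ) * M) ^ ((2 * k : ℝ))⁻¹ := by
  have heven : Even (2 * k) := even_two_mul k
  unfold gradWnorm
  simp only [heven.pow_abs]
  refine Real.rpow_le_rpow (add_nonneg
    (Finset.sum_nonneg fun r _ => Finset.sum_nonneg fun s _ => heven.pow_nonneg _)
    (Finset.sum_nonneg fun l _ => heven.pow_nonneg _)) ?_ (by positivity)
  calc _ ≤ (∑ _r : Fin m, ∑ _s : Fin d, M) + ∑ _l : Fin p, M := by
        gcongr with r _ s _ l _
        · exact h₁ r s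
        · exact h₂ l
    _ = ((m * d + p : ℕ) : ℝ) * M := by
        simp only [Finset.sum_const, Finset.card_univ, Fintype.card_fin, nsmul_eq_mul]
        push_cast
        ring

end Gradient

lemma le_of_average_pow_le {n : ℕ} {k : ℕ} (hn : 0 < n) {g : Fin n → ℝ} {M : ℝ}
    (h : (1 / (n : ℝ)) * ∑ i, g i ^ (2 * k) ≤ M) (i : Fin n) : g i ^ (2 * k) ≤ n * M := by
  have hn' : (0 : ℝ) < n := Nat.cast_pos.mpr hn
  rw [one_div, inv_mul_le_iff₀ hn'] at h
  exact (Finset.single_le_sum (f := fun i => g i ^ (2 * k))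
    (fun j _ => (even_two_mul k).pow_nonneg (g j)) (Finset.mem_univ i)).trans h

lemma moment_rpow_le {B k : ℕ} (hk : 1 ≤ k) (hB : 1 ≤ B) {η N w : ℝ} (hη : 0 < η) (hN : 0 ≤ N)
    (hw : 0 ≤ w) :
    (w * (N * (2 ^ k * (B : ℝ) ^ (k - 1) / η ^ k))) ^ ((2 * k : ℝ))⁻¹ ≤
      (2 * N * w / (B : ℝ)) ^ ((2 * k : ℝ))⁻¹ * Real.sqrt (2 * (B : ℝ) / η) := by
  have hB' : (0 : ℝ) < B := Nat.cast_pos.mpr hB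
  have hs : Real.sqrt (2 * (B : ℝ) / η) = ((2 * (B : ℝ) / η) ^ k) ^ ((2 * k : ℝ))⁻¹ := by
    conv_rhs => rw [← Real.sq_sqrt (show 0 ≤ 2 * (B : ℝ) / η by positivity), ← pow_mul]
    rw [rpow_inv_two_mul_pow hk (Real.sqrt_nonneg _)]
  rw [hs, ← Real.mul_rpow (by positivity) (by positivity)]
  refine Real.rpow_le_rpow (by positivity) ?_ (by positivity)
  obtain ⟨j, rfl⟩ := Nat.exists_eq_add_of_le' hk
  have hpos : 0 ≤ w * (N * (2 ^ (j + 1) * (B : ℝ) ^ j / η ^ (j + 1))) := by positivity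
  calc w * (N * (2 ^ (j + 1) * (B : ℝ) ^ (j + 1 - 1) / η ^ (j + 1)))
      ≤ 2 * (w * (N * (2 ^ (j + 1) * (B : ℝ) ^ j / η ^ (j + 1)))) := by
        rw [Nat.add_sub_cancel]; linarith
    _ = 2 * N * w / B * (2 * B / η) ^ (j + 1) := by
        rw [div_pow, mul_pow]
        field_simp
        ring

/-- A perturbation of the input can be absorbed by a rank-one perturbation of the first-layer
weights. -/
lemma exists_weights_mVec_eq {m d p : ℕ} (W : (Fin m → Fin d → ℝ) × (Fin p → ℝ))
    {x : Fin d → ℝ} (hx : x ≠ 0) (v : Fin d → ℝ) :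
    ∃ W' : (Fin m → Fin d → ℝ) × (Fin p → ℝ), W'.2 = W.2 ∧ mVec W'.1 x = mVec W.1 (x + v) ∧
      paramDist W' W = l2norm (mVec W.1 v) / l2norm x := by
  have hpos : 0 < l2norm x := by
    rw [l2norm_eq_lpnorm_one]; exact lpnorm_pos le_rfl hx
  have hsq : ∑ s, x s ^ 2 = l2norm x ^ 2 := (Real.sq_sqrt (by positivity)).symm
  refine ⟨(fun r s => W.1 r s + mVec W.1 v r * x s / l2norm x ^ 2, W.2), rfl, ?_, ?_⟩
  · rw [mVec_add]
    ext r
    simp only [mVec, Pi.add_apply, add_mul, Finset.sum_add_distrib]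
    congr 1
    calc ∑ s, (∑ t, W.1 r t * v t) * x s / l2norm x ^ 2 * x s
        = (∑ t, W.1 r t * v t) / l2norm x ^ 2 * ∑ s, x s ^ 2 := by
          rw [Finset.mul_sum]
          exact Finset.sum_congr rfl fun s _ => by ring
      _ = ∑ t, W.1 r t * v t := by
          rw [hsq]; field_simp
  · have hsum : (∑ r, ∑ s, (mVec W.1 v r * x s / l2norm x ^ 2) ^ 2) =
        (l2norm (mVec W.1 v) / l2norm x) ^ 2 := by
      have hv : ∑ r, mVec W.1 v r ^ 2 = l2norm (mVec W.1 v) ^ 2 :=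
        (Real.sq_sqrt (by positivity)).symm
      calc _ = (∑ r, mVec W.1 v r ^ 2) * (∑ s, x s ^ 2) / l2norm x ^ 4 := by
            rw [Finset.sum_mul_sum, Finset.sum_div]
            refine Finset.sum_congr rfl fun r _ => ?_
            rw [Finset.sum_div]
            exact Finset.sum_congr rfl fun s _ => by ring
        _ = _ := by rw [hv, hsq]; field_simp
    simp only [paramDist, add_sub_cancel_left, sub_self, ne_eq, OfNat.ofNat_ne_zero,
      not_false_eq_true, zero_pow, Finset.sum_const_zero, add_zero]
    rw [hsum, Real.sqrt_sq (div_nonneg (by unfold l2norm; positivity) hpos.le)]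

/-- Mean value theorem for the network output along a segment in input space. -/
lemma exists_fderiv_eq_sub {m d p : ℕ} {ft : (Fin m → ℝ) → (Fin p → ℝ) → ℝ}
    (hft : Differentiable ℝ (fun q : (Fin m → ℝ) × (Fin p → ℝ) => ft q.1 q.2))
    (W : Fin m → Fin d → ℝ) (W₂ : Fin p → ℝ) (x v : Fin d → ℝ) :
    ∃ c ∈ Set.Ioo (0 : ℝ) 1, ft (mVec W (x + v)) W₂ - ft (mVec W x) W₂ =
      fderiv ℝ (fun q : (Fin m → ℝ) × (Fin p → ℝ) => ft q.1 q.2) (mVec W (x + c • v), W₂)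
        (mVec W v, 0) := by
  have hline : ∀ c : ℝ, HasDerivAt (fun t : ℝ => (mVec W (x + t • v), W₂)) (mVec W v, 0) c := by
    intro c
    refine HasDerivAt.prodMk ?_ (hasDerivAt_const c W₂)
    simp only [mVec_add, mVec_smul]
    simpa using ((hasDerivAt_id c).smul_const (mVec W v)).const_add (mVec W x)
  have hder : ∀ c : ℝ, HasDerivAt (fun t : ℝ => ft (mVec W (x + t • v)) W₂)
      (fderiv ℝ (fun q : (Fin m → ℝ) × (Fin p → ℝ) => ft q.1 q.2) (mVec W (x + c • v), W₂)
        (mVec W v, 0)) c := fun c =>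
    HasFDerivAt.comp_hasDerivAt (l := fun q : (Fin m → ℝ) × (Fin p → ℝ) => ft q.1 q.2) c
      (hft (mVec W (x + c • v), W₂)).hasFDerivAt (hline c)
  obtain ⟨c, hc, h⟩ := exists_hasDerivAt_eq_slope _ _ zero_lt_one
    (fun t _ => (hder t).continuousAt.continuousWithinAt) (fun t _ => hder t)
  refine ⟨c, hc, ?_⟩
  rw [h]
  simp

lemma fderiv_prodMk_zero_eq_sum {m d p : ℕ} (D : (Fin m → ℝ) × (Fin p → ℝ) →L[ℝ] ℝ)
    (W : Fin m → Fin d → ℝ) (v : Fin d → ℝ) :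
    D (mVec W v, 0) = ∑ s, mVec (fun s r => W r s) (fun r => D (Pi.single r 1, 0)) s * v s := by
  have hsingle : ∀ r : Fin m, (Pi.single r 1 : Fin m → ℝ) = fun t => if r = t then 1 else 0 :=
    fun r => by ext t; simp [Pi.single_apply, eq_comm]
  have h : D (mVec W v, 0) = ∑ r, mVec W v r * D (Pi.single r 1, 0) := by
    have := (D.toLinearMap ∘ₗ LinearMap.inl ℝ (Fin m → ℝ) (Fin p → ℝ)).pi_apply_eq_sum_univ
      (mVec W v)
    simpa [hsingle] using this
  rw [h]
  simp only [mVec, Finset.sum_mul]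
  rw [Finset.sum_comm]
  exact Finset.sum_congr rfl fun s _ => Finset.sum_congr rfl fun r _ => by ring

/-- adversarial robustness bound: for `x` within distance `δ` of a training
point `xᵢ`, `|f(x, W*) − f(xᵢ, W*)| ≤ (C√d‖(W₁*)ᵀ‖_{2k}/minⱼ‖xⱼ‖_{2k})
((2nw/B)^{1/(2k)} √(2B/η) + 1) δ`. -/
theorem adversarial_robustness_bound
    {m d p n : ℕ} (hn : 0 < n) (B k : ℕ) (hk : 1 ≤ k) (hB : 1 ≤ B)
    (η : ℝ) (hη : 0 < η)
    (C δa δ : ℝ) (hC : 0 < C) (hδa : 0 < δa)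
    (ft : (Fin m → ℝ) → (Fin p → ℝ) → ℝ)
    (hft : Differentiable ℝ (fun q : (Fin m → ℝ) × (Fin p → ℝ) => ft q.1 q.2))
    (x : Fin n → Fin d → ℝ) (hx : ∀ i, x i ≠ 0) (y : Fin n → ℝ)
    (Wstar : (Fin m → Fin d → ℝ) × (Fin p → ℝ))
    (hinterp : ∀ i, ft (mVec Wstar.1 (x i)) Wstar.2 = y i)
    (hmom1 : ∀ (r : Fin m) (s : Fin d),
      (1 / (n : ℝ)) * ∑ i,
          (fderiv ℝ (fun V : (Fin m → Fin d → ℝ) × (Fin p → ℝ) => ft (mVec V.1 (x i)) V.2)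
            Wstar (Pi.single r (Pi.single s 1), 0)) ^ (2 * k)
        ≤ 2 ^ k * (B : ℝ) ^ (k - 1) / η ^ k)
    (hmom2 : ∀ l : Fin p,
      (1 / (n : ℝ)) * ∑ i,
          (fderiv ℝ (fun V : (Fin m → Fin d → ℝ) × (Fin p → ℝ) => ft (mVec V.1 (x i)) V.2)
            Wstar (0, Pi.single l 1)) ^ (2 * k)
        ≤ 2 ^ k * (B : ℝ) ^ (k - 1) / η ^ k)
    (hsmooth : ∀ i, ∀ W' : (Fin m → Fin d → ℝ) × (Fin p → ℝ), paramDist W' Wstar ≤ δa →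
      gradWnorm k (fun V => ft (mVec V.1 (x i)) V.2) W'
        ≤ C * (gradWnorm k (fun V => ft (mVec V.1 (x i)) V.2) Wstar + 1))
    (hδsmall : δ ≤ δa *
        (Finset.univ.inf' ⟨⟨0, hn⟩, Finset.mem_univ _⟩ fun j => l2norm (x j)) /
        opNorm2 Wstar.1)
    (i : Fin n) (z : Fin d → ℝ) (hz : l2norm (fun t => z t - x i t) ≤ δ) :
    |ft (mVec Wstar.1 z) Wstar.2 - ft (mVec Wstar.1 (x i)) Wstar.2|
      ≤ C * Real.sqrt d * opNormP k (fun s r => Wstar.1 r s) /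
          (Finset.univ.inf' ⟨⟨0, hn⟩, Finset.mem_univ _⟩ fun j => lpnorm k (x j)) *
        ((2 * (n : ℝ) * ((m * d + p : ℕ) : ℝ) / (B : ℝ)) ^ ((2 * k : ℝ))⁻¹ *
            Real.sqrt (2 * (B : ℝ) / η) + 1) * δ := by
  set mx := Finset.univ.inf' ⟨⟨0, hn⟩, Finset.mem_univ _⟩ fun j => lpnorm k (x j)
  set m2 := Finset.univ.inf' ⟨⟨0, hn⟩, Finset.mem_univ _⟩ fun j => l2norm (x j)
  have hmx_pos : 0 < mx := by
    exact (Finset.lt_inf'_iff _).mpr fun j _ => lpnorm_pos hk (hx j)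
  have hmx_le : mx ≤ lpnorm k (x i) := Finset.inf'_le _ (Finset.mem_univ i)
  have hm2_le : m2 ≤ l2norm (x i) := Finset.inf'_le _ (Finset.mem_univ i)
  have hxi : 0 < l2norm (x i) := by
    rw [l2norm_eq_lpnorm_one]; exact lpnorm_pos le_rfl (hx i)
  have hop : 0 ≤ opNorm2 Wstar.1 := opNorm2_eq_opNormP_one Wstar.1 ▸ opNormP_nonneg _
  set v : Fin d → ℝ := fun t => z t - x i t with hv
  have hzv : z = x i + v := by
    ext t; simp [hv]
  obtain ⟨c, hc, hmvt⟩ := exists_fderiv_eq_sub hft Wstar.1 Wstar.2 (x i) v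
  obtain ⟨W', hW₂, hW₁, hdist⟩ := exists_weights_mVec_eq Wstar (hx i) (c • v)
  have hclose : paramDist W' Wstar ≤ δa := by
    rw [hdist, div_le_iff₀ hxi]
    have hδ : opNorm2 Wstar.1 * δ ≤ δa * m2 := by
      rcases hop.eq_or_lt with h0 | h0
      · rw [← h0, zero_mul]
        refine mul_nonneg hδa.le ?_
        exact Finset.le_inf' _ _ fun j _ => Real.sqrt_nonneg _
      · rwa [le_div_iff₀ h0, mul_comm] at hδsmall
    have hcv : l2norm (c • v) ≤ δ := by
      rw [l2norm_eq_lpnorm_one, lpnorm_smul le_rfl, ← l2norm_eq_lpnorm_one, abs_of_pos hc.1]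
      exact (mul_le_of_le_one_left (Real.sqrt_nonneg _) hc.2.le).trans hz
    calc l2norm (mVec Wstar.1 (c • v)) ≤ opNorm2 Wstar.1 * l2norm (c • v) := l2norm_mVec_le _ _
      _ ≤ opNorm2 Wstar.1 * δ := by gcongr
      _ ≤ δa * m2 := hδ
      _ ≤ δa * l2norm (x i) := by gcongr
  have hgrad := (gradWnorm_le_of_pow_le (fun r s => le_of_average_pow_le hn (hmom1 r s) i)
    (fun l => le_of_average_pow_le hn (hmom2 l) i)).trans
    (moment_rpow_le hk hB hη (Nat.cast_nonneg n) (Nat.cast_nonneg (m * d + p)))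
  have hg := lpnorm_mul_lpnorm_le_gradWnorm (k := k) hft (x i) W'
  rw [hW₁, hW₂] at hg
  rw [hzv, hmvt, fderiv_prodMk_zero_eq_sum]
  set g : Fin m → ℝ := fun r =>
    fderiv ℝ (fun q : (Fin m → ℝ) × (Fin p → ℝ) => ft q.1 q.2)
      (mVec Wstar.1 (x i + c • v), Wstar.2) (Pi.single r 1, 0)
  set K := (2 * (n : ℝ) * ((m * d + p : ℕ) : ℝ) / (B : ℝ)) ^ ((2 * k : ℝ))⁻¹ *
    Real.sqrt (2 * (B : ℝ) / η)
  have hgK : lpnorm k g ≤ C * (K + 1) / mx := by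
    rw [le_div_iff₀ hmx_pos]
    calc lpnorm k g * mx ≤ lpnorm k g * lpnorm k (x i) := by
          gcongr
          exact lpnorm_nonneg g
      _ ≤ _ := hg
      _ ≤ _ := hsmooth i W' hclose
      _ ≤ C * (K + 1) := by gcongr
  have hP : 0 ≤ opNormP k (fun s r => Wstar.1 r s) := opNormP_nonneg _
  calc _ ≤ lpnorm k (mVec (fun s r => Wstar.1 r s) g) * (Real.sqrt d * l2norm v) :=
        abs_sum_mul_le_lpnorm_mul_l2norm hk _ _
    _ ≤ opNormP k (fun s r => Wstar.1 r s) * (C * (K + 1) / mx) * (Real.sqrt d * δ) := by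
        have hv0 : 0 ≤ l2norm v := Real.sqrt_nonneg _
        have hg0 : 0 ≤ C * (K + 1) / mx := (lpnorm_nonneg g).trans hgK
        gcongr
        exact (lpnorm_mVec_le hk _ g).trans (by gcongr)
    _ = _ := by ring
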